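/- Let r, n be positive integers with 2 ≤ 2r ≤ n. Let Z = {(i,j) ∈ ℤ×ℤ : 1 ≤ i < j ≤ n}, and set P_i = (i, i+1) and Q_i = (n−i, n−i+1) for i = 1, …, r−1. Then the number of (r−1)-tuples of non-intersecting increasing paths in Z from P_1, …, P_{r−1} to Q_1, …, Q_{r−1} equals det[ C(2n−2r−i−j, n−r−i) − C(2n−2r−i−j, n−2r−1) ]_{i,j=1,…,r−1}. (By the paper's Corollary 4.4, this number is the multiplicity of the pfaffian ring K[X]/Q_r of a generic skew-symmetric n×n matrix.) -/

import Mathlib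

/-- An increasing (lattice) path in `Z` from `P` to `Q`: a nonempty finite sequence of points
of `Z` starting at `P`, ending at `Q`, each step increasing either the first or the second
coordinate by 1. -/
def IPath (Z : Set (ℤ × ℤ)) (P Q : ℤ × ℤ) (c : List (ℤ × ℤ)) : Prop :=
  c.head? = some P ∧ c.getLast? = some Q ∧ (∀ p ∈ c, p ∈ Z) ∧
  List.Chain' (fun p q : ℤ × ℤ => q = (p.1 + 1, p.2) ∨ q = (p.1, p.2 + 1)) c

/-- The number of `s`-tuples of pairwise non-intersecting increasing paths in `Z`
from `P i` to `Q i`. -/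
noncomputable def inipCount (Z : Set (ℤ × ℤ)) {s : ℕ} (P Q : Fin s → ℤ × ℤ) : ℕ :=
  Nat.card {C : Fin s → List (ℤ × ℤ) //
    (∀ i, IPath Z (P i) (Q i) (C i)) ∧
    ∀ i j, i ≠ j → ∀ p ∈ C i, p ∉ C j}

/-- The binomial coefficient `C(N, x)` for integers, with the convention that it is `0`
when `N < 0`, `x < 0`, or `x > N`. -/
def ibinom (N x : ℤ) : ℤ :=
  if 0 ≤ N ∧ 0 ≤ x then (N.toNat.choose x.toNat : ℤ) else 0

/-- The index set `T = {(a,b) : a − b = 0 or a − b = 1}`. -/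
def Tset : Set (ℤ × ℤ) := {p : ℤ × ℤ | p.1 - p.2 = 0 ∨ p.1 - p.2 = 1}

/-- The set of families of pairwise non-intersecting increasing paths counted by `inipCount`. -/
def inipFamilies (Z : Set (ℤ × ℤ)) {s : ℕ} (P Q : Fin s → ℤ × ℤ) : Set (Fin s → List (ℤ × ℤ)) :=
  {C | (∀ i, IPath Z (P i) (Q i) (C i)) ∧ ∀ i j, i ≠ j → ∀ p ∈ C i, p ∉ C j}

theorem inipCount_eq_ncard (Z : Set (ℤ × ℤ)) {s : ℕ} (P Q : Fin s → ℤ × ℤ) :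
    inipCount Z P Q = (inipFamilies Z P Q).ncard := rfl

section IPath

variable {Z : Set (ℤ × ℤ)} {P Q : ℤ × ℤ}

theorem IPath.ne_nil {c : List (ℤ × ℤ)} (h : IPath Z P Q c) : c ≠ [] := by
  rintro rfl
  simp [IPath] at h

theorem IPath.end_mem {c : List (ℤ × ℤ)} (h : IPath Z P Q c) : Q ∈ c :=
  List.mem_of_getLast? h.2.1

theorem ipath_singleton_iff {q : ℤ × ℤ} : IPath Z P Q [q] ↔ q = P ∧ q = Q ∧ q ∈ Z := by
  simp [IPath, List.Chain']

/-- A path with at least two points is a shorter path followed by its endpoint. -/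
theorem ipath_concat_iff {c : List (ℤ × ℤ)} {q : ℤ × ℤ} (hc : c ≠ []) :
    IPath Z P Q (c ++ [q]) ↔ q = Q ∧ Q ∈ Z ∧
      (IPath Z P (Q.1 - 1, Q.2) c ∨ IPath Z P (Q.1, Q.2 - 1) c) := by
  obtain ⟨d, y, rfl⟩ : ∃ d y, c = d ++ [y] :=
    ⟨c.dropLast, c.getLast hc, (List.dropLast_append_getLast hc).symm⟩
  have hstep : (Q = (y.1 + 1, y.2) ∨ Q = (y.1, y.2 + 1)) ↔
      (y = (Q.1 - 1, Q.2) ∨ y = (Q.1, Q.2 - 1)) := by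
    obtain ⟨a, b⟩ := Q
    obtain ⟨u, v⟩ := y
    simp only [Prod.mk.injEq]
    omega
  have hhead : (d ++ [y] ++ [q]).head? = (d ++ [y]).head? := by
    cases d <;> simp
  have hlast : (d ++ [y]).getLast? = some y := by simp
  have hlast' : (d ++ [y] ++ [q]).getLast? = some q := by simp
  unfold IPath
  rw [hhead, hlast, hlast', List.Chain', List.isChain_append (l₁ := d ++ [y]), hlast]
  simp only [Option.some.injEq, List.mem_append, List.mem_singleton, List.isChain_singleton,
    List.head?_cons, Option.mem_def, true_and, forall_eq']
  constructor
  · rintro ⟨h1, rfl, h3, h4, h5⟩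
    refine ⟨rfl, h3 _ (Or.inr rfl), ?_⟩
    rcases hstep.1 h5 with h | h
    · exact Or.inl ⟨h1, h, fun p hp => h3 p (Or.inl hp), h4⟩
    · exact Or.inr ⟨h1, h, fun p hp => h3 p (Or.inl hp), h4⟩
  · rintro ⟨rfl, h2, ⟨h1, h, h3, h4⟩ | ⟨h1, h, h3, h4⟩⟩
    · refine ⟨h1, rfl, ?_, h4, hstep.2 (Or.inl h)⟩
      rintro p (hp | rfl)
      exacts [h3 p hp, h2]
    · refine ⟨h1, rfl, ?_, h4, hstep.2 (Or.inr h)⟩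
      rintro p (hp | rfl)
      exacts [h3 p hp, h2]

theorem IPath.cases {c : List (ℤ × ℤ)} (h : IPath Z P Q c) :
    (c = [Q] ∧ P = Q) ∨ ∃ d, c = d ++ [Q] ∧
      (IPath Z P (Q.1 - 1, Q.2) d ∨ IPath Z P (Q.1, Q.2 - 1) d) := by
  obtain ⟨d, q, rfl⟩ : ∃ d q, c = d ++ [q] :=
    ⟨c.dropLast, c.getLast h.ne_nil, (List.dropLast_append_getLast h.ne_nil).symm⟩
  rcases eq_or_ne d [] with rfl | hd
  · rw [List.nil_append, ipath_singleton_iff] at h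
    obtain ⟨rfl, rfl, -⟩ := h
    simp
  · obtain ⟨rfl, -, h3⟩ := (ipath_concat_iff hd).1 h
    exact Or.inr ⟨d, rfl, h3⟩

theorem IPath.mem_bounds {c : List (ℤ × ℤ)} (h : IPath Z P Q c) :
    ∀ p ∈ c, P ≤ p ∧ p ≤ Q := by
  induction hn : c.length generalizing c Q with
  | zero => exact absurd (List.length_eq_zero_iff.1 hn) h.ne_nil
  | succ k ih =>
    rcases h.cases with ⟨rfl, rfl⟩ | ⟨d, rfl, hd⟩
    · simp
    · have hk : d.length = k := by simpa using hn
      intro p hp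
      rcases hd with hd | hd
      all_goals
        have hP := (ih hd hk _ hd.end_mem).1
        rcases List.mem_append.1 hp with hp | hp
        · have := ih hd hk p hp
          simp only [Prod.le_def] at this ⊢
          omega
        · rw [List.mem_singleton] at hp
          subst hp
          simp only [Prod.le_def] at hP ⊢
          omega

theorem IPath.length_eq {c : List (ℤ × ℤ)} (h : IPath Z P Q c) :
    (c.length : ℤ) = Q.1 + Q.2 - P.1 - P.2 + 1 := by
  induction hn : c.length generalizing c Q with
  | zero => exact absurd (List.length_eq_zero_iff.1 hn) h.ne_nil
  | succ k ih =>
    rcases h.cases with ⟨rfl, rfl⟩ | ⟨d, rfl, hd⟩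
    · simp at hn
      subst hn
      push_cast
      ring
    · have hk : d.length = k := by simpa using hn
      rcases hd with hd | hd
      all_goals
        have := ih hd hk
        simp only at this
        push_cast
        linarith

theorem finite_setOf_ipath (Z : Set (ℤ × ℤ)) (P Q : ℤ × ℤ) : {c | IPath Z P Q c}.Finite := by
  have key : ∀ (k : ℕ) (Q : ℤ × ℤ), {c | IPath Z P Q c ∧ c.length = k}.Finite := by
    intro k
    induction k with
    | zero =>
      intro Q
      convert Set.finite_empty
      ext c
      simp only [Set.mem_ofPred_eq, Set.mem_empty_iff_false, iff_false, not_and]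
      exact fun h h0 => h.ne_nil (List.length_eq_zero_iff.1 h0)
    | succ k ih =>
      intro Q
      refine (((((ih (Q.1 - 1, Q.2)).union (ih (Q.1, Q.2 - 1))).image (· ++ [Q])).union
        (Set.finite_singleton [Q]))).subset ?_
      rintro c ⟨h, hl⟩
      rcases h.cases with ⟨rfl, rfl⟩ | ⟨d, rfl, hd⟩
      · exact Or.inr rfl
      · have hk : d.length = k := by simpa using hl
        exact Or.inl ⟨d, hd.imp (⟨·, hk⟩) (⟨·, hk⟩), rfl⟩
  refine (key (Q.1 + Q.2 - P.1 - P.2 + 1).toNat Q).subset fun c h => ⟨h, ?_⟩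
  have := IPath.length_eq h
  omega

end IPath

section Families

variable {Z : Set (ℤ × ℤ)} {s : ℕ} {P Q : Fin s → ℤ × ℤ}

theorem inipFamilies_finite (Z : Set (ℤ × ℤ)) (P Q : Fin s → ℤ × ℤ) :
    (inipFamilies Z P Q).Finite :=
  (Set.Finite.pi' fun i => finite_setOf_ipath Z (P i) (Q i)).subset fun _ h => h.1

theorem inipCount_eq_zero_of_notMem {j : Fin s} (hj : Q j ∉ Z) : inipCount Z P Q = 0 := by
  rw [inipCount_eq_ncard, Set.ncard_eq_zero (inipFamilies_finite Z P Q),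
    Set.eq_empty_iff_forall_notMem]
  exact fun C hC => hj ((hC.1 j).2.2.1 _ (hC.1 j).end_mem)

theorem inipCount_eq_zero_of_eq {i j : Fin s} (hij : i ≠ j) (h : Q i = Q j) :
    inipCount Z P Q = 0 := by
  rw [inipCount_eq_ncard, Set.ncard_eq_zero (inipFamilies_finite Z P Q),
    Set.eq_empty_iff_forall_notMem]
  exact fun C hC => hC.2 i j hij _ (hC.1 i).end_mem (h ▸ (hC.1 j).end_mem)

/-- If the endpoint `Q j` lies below no other endpoint, families are classified by the last step
of their `j`-th path. -/
theorem inipCount_eq_add {j : Fin s} (hj : Q j ∈ Z) (hPQ : P j ≠ Q j)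
    (hmax : ∀ k, k ≠ j → ¬ Q j ≤ Q k) :
    inipCount Z P Q = inipCount Z P (Function.update Q j ((Q j).1 - 1, (Q j).2)) +
      inipCount Z P (Function.update Q j ((Q j).1, (Q j).2 - 1)) := by
  simp only [inipCount_eq_ncard]
  set φ : (Fin s → List (ℤ × ℤ)) → (Fin s → List (ℤ × ℤ)) :=
    fun C => Function.update C j (C j ++ [Q j]) with hφ
  have hinj : Function.Injective φ := by
    intro C D h
    funext k
    have hk := congrFun h k
    rcases eq_or_ne k j with rfl | hkj
    · simpa [hφ] using hk
    · simpa [hφ, hkj] using hk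
  have hdisj : Disjoint (inipFamilies Z P (Function.update Q j ((Q j).1 - 1, (Q j).2)))
      (inipFamilies Z P (Function.update Q j ((Q j).1, (Q j).2 - 1))) := by
    rw [Set.disjoint_left]
    intro C h1 h2
    have e1 := (h1.1 j).2.1
    have e2 := (h2.1 j).2.1
    rw [e1] at e2
    simp at e2
  rw [← Set.ncard_union_eq hdisj (inipFamilies_finite _ _ _) (inipFamilies_finite _ _ _),
    ← Set.ncard_image_of_injective (_ ∪ _) hinj]
  congr 1
  have hback : ∀ (y : ℤ × ℤ) (C : Fin s → List (ℤ × ℤ)),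
      (y = ((Q j).1 - 1, (Q j).2) ∨ y = ((Q j).1, (Q j).2 - 1)) →
      C ∈ inipFamilies Z P (Function.update Q j y) → φ C ∈ inipFamilies Z P Q := by
    intro y C hy hC
    have hpath : ∀ k, k ≠ j → IPath Z (P k) (Q k) (C k) := by
      intro k hk
      simpa [hk] using hC.1 k
    have hQ : ∀ k, k ≠ j → Q j ∉ C k := fun k hk hm =>
      hmax k hk ((hpath k hk).mem_bounds _ hm).2
    have hCj : IPath Z (P j) y (C j) := by simpa using hC.1 j
    refine ⟨fun k => ?_, fun i k hik p hp => ?_⟩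
    · rcases eq_or_ne k j with rfl | hk
      · simp only [hφ, Function.update_self]
        rw [ipath_concat_iff hCj.ne_nil]
        exact ⟨rfl, hj, hy.imp (by rintro rfl; exact hCj) (by rintro rfl; exact hCj)⟩
      · simpa [hφ, hk] using hpath k hk
    · rcases eq_or_ne i j with rfl | hi
      · have hki : k ≠ i := hik.symm
        simp only [hφ, Function.update_self, Function.update_of_ne hki, List.mem_append,
          List.mem_singleton] at hp ⊢
        rcases hp with hp | rfl
        · exact hC.2 i k hik p hp
        · exact hQ k hki
      · simp only [hφ, Function.update_of_ne hi] at hp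
        rcases eq_or_ne k j with rfl | hk
        · simp only [hφ, Function.update_self, List.mem_append, List.mem_singleton, not_or]
          exact ⟨hC.2 i k hik p hp, fun h => hQ i hi (h ▸ hp)⟩
        · simp only [hφ, Function.update_of_ne hk]
          exact hC.2 i k hik p hp
  ext C
  constructor
  · intro hC
    rcases (hC.1 j).cases with ⟨-, h⟩ | ⟨d, hd, hd'⟩
    · exact absurd h hPQ
    · have hmem : ∀ y, IPath Z (P j) y d →
          Function.update C j d ∈ inipFamilies Z P (Function.update Q j y) := by
        intro y hy
        have hsub : ∀ k, ∀ p ∈ Function.update C j d k, p ∈ C k := by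
          intro k p hp
          rcases eq_or_ne k j with rfl | hk
          · rw [Function.update_self] at hp
            rw [hd]
            exact List.mem_append_left _ hp
          · rwa [Function.update_of_ne hk] at hp
        refine ⟨fun k => ?_, fun i k hik p hp hp' =>
          hC.2 i k hik p (hsub i p hp) (hsub k p hp')⟩
        rcases eq_or_ne k j with rfl | hk
        · simpa using hy
        · simpa [hk] using hC.1 k
      refine ⟨Function.update C j d, hd'.imp (hmem _) (hmem _), ?_⟩
      simp [hφ, ← hd]
  · rintro ⟨D, hD | hD, rfl⟩
    · exact hback _ D (Or.inl rfl) hD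
    · exact hback _ D (Or.inr rfl) hD

theorem inipCount_self (hP : Function.Injective P) (hPZ : ∀ i, P i ∈ Z) :
    inipCount Z P P = 1 := by
  rw [inipCount_eq_ncard, Set.ncard_eq_one]
  refine ⟨fun i => [P i], ?_⟩
  ext C
  rw [Set.mem_singleton_iff]
  constructor
  · intro hC
    funext i
    obtain ⟨a, ha⟩ := List.length_eq_one_iff.1
      (show (C i).length = 1 by have := (hC.1 i).length_eq; omega)
    have := (hC.1 i)
    rw [ha, ipath_singleton_iff] at this
    rw [ha, this.1]
  · rintro rfl
    refine ⟨fun i => ipath_singleton_iff.2 ⟨rfl, rfl, hPZ i⟩, fun i j hij p hp hp' => ?_⟩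
    rw [List.mem_singleton] at hp hp'
    exact hij (hP (hp.symm.trans hp'))

end Families

section Symmetry

/-- The reflection `(a, b) ↦ (n + 1 - b, n + 1 - a)`, which reverses increasing paths. -/
def antiReflect (n : ℤ) (p : ℤ × ℤ) : ℤ × ℤ := (n + 1 - p.2, n + 1 - p.1)

theorem antiReflect_involutive (n : ℤ) : Function.Involutive (antiReflect n) := by
  intro p
  simp [antiReflect]

theorem IPath.antiReflect {Z : Set (ℤ × ℤ)} {n : ℤ} (hZ : ∀ p ∈ Z, antiReflect n p ∈ Z)
    {P Q : ℤ × ℤ} {c : List (ℤ × ℤ)} (h : IPath Z P Q c) :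
    IPath Z (antiReflect n Q) (antiReflect n P) (c.reverse.map (_root_.antiReflect n)) := by
  obtain ⟨h1, h2, h3, h4⟩ := h
  refine ⟨by simp [h2], by simp [h1], ?_, ?_⟩
  · simp only [List.mem_map, List.mem_reverse]
    rintro _ ⟨p, hp, rfl⟩
    exact hZ p (h3 p hp)
  · rw [List.Chain', List.isChain_map, List.isChain_reverse]
    refine List.IsChain.imp ?_ h4
    rintro p q (rfl | rfl)
    · right
      simp [_root_.antiReflect]
      ring
    · left
      simp [_root_.antiReflect]
      ring

theorem inipCount_antiReflect {Z : Set (ℤ × ℤ)} {n : ℤ} (hZ : ∀ p ∈ Z, antiReflect n p ∈ Z)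
    {s : ℕ} (P Q : Fin s → ℤ × ℤ) :
    inipCount Z (fun i => antiReflect n (Q i)) (fun i => antiReflect n (P i)) =
      inipCount Z P Q := by
  have hinv := antiReflect_involutive n
  set φ : (Fin s → List (ℤ × ℤ)) → (Fin s → List (ℤ × ℤ)) :=
    fun C i => (C i).reverse.map (antiReflect n) with hφ
  have hφφ : Function.Involutive φ := by
    intro C
    funext i
    simp [hφ, List.map_reverse, hinv.comp_self]
  have hmem : ∀ (P Q : Fin s → ℤ × ℤ), ∀ C ∈ inipFamilies Z P Q,
      φ C ∈ inipFamilies Z (fun i => antiReflect n (Q i)) (fun i => antiReflect n (P i)) := by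
    intro P Q C hC
    refine ⟨fun i => (hC.1 i).antiReflect hZ, fun i j hij p hp hp' => ?_⟩
    simp only [hφ, List.mem_map, List.mem_reverse] at hp hp'
    obtain ⟨a, ha, rfl⟩ := hp
    obtain ⟨b, hb, hab⟩ := hp'
    exact hC.2 i j hij a ha (hinv.injective hab ▸ hb)
  rw [inipCount_eq_ncard, inipCount_eq_ncard,
    ← Set.ncard_image_of_injective (inipFamilies Z P Q) hφφ.injective]
  congr 1
  ext C
  constructor
  · intro hC
    refine ⟨φ C, ?_, hφφ C⟩
    have := hmem _ _ C hC
    simpa only [hinv (P _), hinv (Q _)] using this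
  · rintro ⟨D, hD, rfl⟩
    exact hmem _ _ D hD

end Symmetry

/-- The set of positions strictly above the diagonal of an `n × n` matrix. -/
def upperTriangle (n : ℤ) : Set (ℤ × ℤ) := {p | 1 ≤ p.1 ∧ p.1 < p.2 ∧ p.2 ≤ n}

section Truncation

variable {s : ℕ} {n : ℤ}

/-- Intermediate endpoints: on row `n - i`, the first coordinate of the `i`-th endpoint is bounded
above by `a` (by `a - 1` for the first `m` paths) as long as it is at least `c i`. -/
def cappedEnd (s : ℕ) (n : ℤ) (c : ℕ → ℤ) (a : ℤ) (m : ℕ) (i : Fin s) : ℤ × ℤ :=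
  (max (c i) (min (n - ((i : ℕ) + 1)) (if (i : ℕ) < m then a - 1 else a)), n - ((i : ℕ) + 1) + 1)

variable {c : ℕ → ℤ} {P : Fin s → ℤ × ℤ}

theorem inipCount_cappedEnd_succ (hc0 : ∀ i, 0 ≤ c i) (hc : ∀ i, c (i + 1) ≤ c i + 1)
    (hmono : Monotone c) (hcs : ∀ i, i + 1 = s → n - s - 1 ≤ c i)
    (hP : ∀ i : Fin s, (P i).1 ≤ c i) (a : ℤ) {m : ℕ} (hm : m < s) :
    inipCount (upperTriangle n) P (cappedEnd s n c a (m + 1)) =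
      inipCount (upperTriangle n) P (cappedEnd s n c a m) := by
  by_cases hmove : c m < a ∧ a ≤ n - (m + 1)
  · obtain ⟨h1, h2⟩ := hmove
    have hm0 := hc0 m
    set j : Fin s := ⟨m, hm⟩ with hj
    have hval : cappedEnd s n c a m j = (a, n - m) := by
      ext
      · simp [cappedEnd, hj]
        omega
      · simp [cappedEnd, hj]
        ring
    have hleft : Function.update (cappedEnd s n c a m) j
        ((cappedEnd s n c a m j).1 - 1, (cappedEnd s n c a m j).2) =
        cappedEnd s n c a (m + 1) := by
      funext k
      rcases eq_or_ne k j with rfl | hk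
      · rw [Function.update_self, hval]
        ext
        · simp [cappedEnd, hj]
          omega
        · simp [cappedEnd, hj]
          ring
      · have hk' : (k : ℕ) ≠ m := fun h => hk (Fin.ext h)
        rw [Function.update_of_ne hk]
        have : (k : ℕ) < m + 1 ↔ (k : ℕ) < m := by omega
        simp [cappedEnd, this]
    rw [inipCount_eq_add (Q := cappedEnd s n c a m) (j := j), hleft]
    · suffices h : inipCount (upperTriangle n) P (Function.update (cappedEnd s n c a m) j
          ((cappedEnd s n c a m j).1, (cappedEnd s n c a m j).2 - 1)) = 0 by omega
      rcases eq_or_lt_of_le h2 with h2 | h2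
      · apply inipCount_eq_zero_of_notMem (j := j)
        rw [Function.update_self, hval]
        simp only [upperTriangle, Set.mem_ofPred_eq]
        omega
      · have hms : m + 1 < s := by
          by_contra hcon
          have := hcs m (by omega)
          omega
        have hne : (⟨m + 1, hms⟩ : Fin s) ≠ j := by simp [hj]
        apply inipCount_eq_zero_of_eq hne
        rw [Function.update_self, Function.update_of_ne hne, hval]
        have := hc m
        ext
        · simp [cappedEnd]
          omega
        · simp [cappedEnd]
          ring
    · rw [hval]
      simp only [upperTriangle, Set.mem_ofPred_eq]
      omega
    · intro h
      have := hP j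
      rw [h, hval] at this
      simp only [hj] at this
      omega
    · intro k hk hle
      have hk' : (k : ℕ) ≠ m := fun h => hk (Fin.ext h)
      rw [hval] at hle
      obtain ⟨hl1, hl2⟩ := Prod.le_def.1 hle
      simp only [cappedEnd] at hl1 hl2
      have hkm : (k : ℕ) < m := by omega
      rw [if_pos hkm] at hl1
      have := hmono hkm.le
      omega
  · congr 1
    funext k
    by_cases hk : (k : ℕ) = m
    · ext
      · simp [cappedEnd, hk]
        omega
      · simp [cappedEnd, hk]
    · have : (k : ℕ) < m + 1 ↔ (k : ℕ) < m := by omega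
      simp [cappedEnd, this]

theorem inipCount_truncate (hc0 : ∀ i, 0 ≤ c i) (hc : ∀ i, c (i + 1) ≤ c i + 1)
    (hmono : Monotone c) (hcs : ∀ i, i + 1 = s → n - s - 1 ≤ c i)
    (hcn : ∀ i < s, c i ≤ n - (i + 1)) (hP : ∀ i : Fin s, (P i).1 ≤ c i) :
    inipCount (upperTriangle n) P
        (fun i => (n - (((i : ℕ) : ℤ) + 1), n - (((i : ℕ) : ℤ) + 1) + 1)) =
      inipCount (upperTriangle n) P (fun i => (c i, n - (((i : ℕ) : ℤ) + 1) + 1)) := by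
  have hrow : ∀ (a : ℤ) (m : ℕ), m ≤ s →
      inipCount (upperTriangle n) P (cappedEnd s n c a m) =
        inipCount (upperTriangle n) P (cappedEnd s n c a 0) := by
    intro a m
    induction m with
    | zero => exact fun _ => rfl
    | succ m ih =>
      intro hm
      rw [inipCount_cappedEnd_succ hc0 hc hmono hcs hP a hm, ih (by omega)]
  have hend : ∀ a : ℤ, cappedEnd s n c a s = cappedEnd s n c (a - 1) 0 := by
    intro a
    funext i
    simp [cappedEnd]
  have hall : ∀ t : ℕ, inipCount (upperTriangle n) P (cappedEnd s n c (n - t) 0) =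
      inipCount (upperTriangle n) P (cappedEnd s n c n 0) := by
    intro t
    induction t with
    | zero => simp
    | succ t ih =>
      rw [← ih, ← hrow (n - t) s le_rfl, hend]
      congr 2
      push_cast
      ring
  have hfirst : cappedEnd s n c n 0 =
      fun i : Fin s => (n - (((i : ℕ) : ℤ) + 1), n - (((i : ℕ) : ℤ) + 1) + 1) := by
    funext i
    have := hcn i i.isLt
    simp [cappedEnd]
    omega
  have hlast : cappedEnd s n c (n - n.toNat) 0 =
      fun i : Fin s => (c i, n - (((i : ℕ) : ℤ) + 1) + 1) := by
    funext i
    have := hcn i i.isLt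
    have := hc0 i
    simp [cappedEnd]
    omega
  rw [← hfirst, ← hlast, hall]

end Truncation

section ReflectionPrinciple

theorem ibinom_pascal {N : ℤ} (hN : N ≠ 0) (x : ℤ) :
    ibinom N x = ibinom (N - 1) (x - 1) + ibinom (N - 1) x := by
  unfold ibinom
  rcases lt_or_ge N 0 with h | h
  · rw [if_neg (by omega), if_neg (by omega), if_neg (by omega), add_zero]
  · obtain ⟨k, rfl⟩ : ∃ k : ℕ, N = k + 1 := ⟨(N - 1).toNat, by omega⟩
    rcases lt_trichotomy x 0 with hx | rfl | hx
    · rw [if_neg (by omega), if_neg (by omega), if_neg (by omega), add_zero]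
    · simp [h]
    · obtain ⟨l, rfl⟩ : ∃ l : ℕ, x = l + 1 := ⟨(x - 1).toNat, by omega⟩
      rw [if_pos (by omega), if_pos (by omega), if_pos (by omega)]
      have e1 : ((k : ℤ) + 1).toNat = k + 1 := by omega
      have e2 : ((l : ℤ) + 1).toNat = l + 1 := by omega
      simp only [add_sub_cancel_right, Int.toNat_natCast, e1, e2, Nat.choose_succ_succ]
      push_cast
      rfl

theorem ibinom_symm {N : ℤ} (hN : 0 ≤ N) (x : ℤ) : ibinom N (N - x) = ibinom N x := by
  unfold ibinom
  obtain ⟨k, rfl⟩ := Int.eq_ofNat_of_zero_le hN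
  rcases lt_or_ge x 0 with hx | hx
  · rw [if_neg (by omega : ¬(0 ≤ (k : ℤ) ∧ 0 ≤ x)), if_pos (by omega),
      Nat.choose_eq_zero_of_lt (by omega), Nat.cast_zero]
  · rcases lt_or_ge (k : ℤ) x with hk | hk
    · rw [if_neg (by omega), if_pos (by omega), Nat.choose_eq_zero_of_lt (by omega), Nat.cast_zero]
    · rw [if_pos (by omega), if_pos (by omega)]
      congr 1
      exact Nat.choose_symm_of_eq_add (by omega)

theorem ibinom_of_neg {N x : ℤ} (hx : x < 0) : ibinom N x = 0 :=
  if_neg (by omega)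

theorem ibinom_zero {N : ℤ} (hN : 0 ≤ N) : ibinom N 0 = 1 := by
  simp [ibinom, hN]

/-- The number of increasing paths from `(i, r + 1)` to `x` avoiding the diagonal, as given by the
reflection principle. -/
def reflectedCount (r i : ℤ) (x : ℤ × ℤ) : ℤ :=
  ibinom (x.1 + x.2 - i - r - 1) (x.1 - i) - ibinom (x.1 + x.2 - i - r - 1) (x.1 - r - 1)

theorem reflectedCount_eq_add {r i : ℤ} {x : ℤ × ℤ} (h : x.1 + x.2 - i - r - 1 ≠ 0) :
    reflectedCount r i x =
      reflectedCount r i (x.1 - 1, x.2) + reflectedCount r i (x.1, x.2 - 1) := by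
  have e1 : x.1 - 1 + x.2 - i - r - 1 = x.1 + x.2 - i - r - 1 - 1 := by ring
  have e2 : x.1 + (x.2 - 1) - i - r - 1 = x.1 + x.2 - i - r - 1 - 1 := by ring
  have e3 : x.1 - 1 - i = x.1 - i - 1 := by ring
  have e4 : x.1 - 1 - r - 1 = x.1 - r - 1 - 1 := by ring
  simp only [reflectedCount, e1, e2, e3, e4]
  rw [ibinom_pascal h (x.1 - i), ibinom_pascal h (x.1 - r - 1)]
  ring

theorem reflectedCount_diag {r i : ℤ} {x : ℤ × ℤ} (hx : x.1 = x.2)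
    (h : 0 ≤ x.1 + x.2 - i - r - 1) : reflectedCount r i x = 0 := by
  unfold reflectedCount
  rw [← ibinom_symm h (x.1 - i), sub_eq_zero]
  congr 1
  omega

end ReflectionPrinciple

/-- The number of families of non-intersecting paths starting at level `2 (s + 1)` is the
determinant of the numbers of single paths from `(i + 1, s + 2)`. -/
theorem inipCount_eq_det_reflectedCount {s : ℕ} {n : ℤ}
    (x : Fin s → ℤ × ℤ)
    (hx : ∀ i, 0 ≤ (x i).1 ∧ (x i).1 ≤ (x i).2 ∧ (x i).2 ≤ n ∧
      2 * ((s : ℤ) + 1) ≤ (x i).1 + (x i).2)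
    (hmono : ∀ i j, i ≤ j → (x i).1 ≤ (x j).1) (hanti : ∀ i j, i ≤ j → (x j).2 ≤ (x i).2) :
    (inipCount (upperTriangle n)
      (fun i : Fin s => (((i : ℕ) : ℤ) + 1, 2 * (s : ℤ) + 1 - (i : ℕ))) x : ℤ) =
      Matrix.det (Matrix.of fun i j : Fin s =>
        reflectedCount ((s : ℤ) + 1) (((i : ℕ) : ℤ) + 1) (x j)) := by
  induction hk : (∑ i, ((x i).1 + (x i).2 - 2 * ((s : ℤ) + 1))).toNat using Nat.strong_induction_on
    generalizing x with
  | _ k ih =>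
  by_cases hZ : ∃ j, x j ∉ upperTriangle n
  · obtain ⟨j, hj⟩ := hZ
    rw [inipCount_eq_zero_of_notMem hj, Nat.cast_zero]
    refine (Matrix.det_eq_zero_of_column_eq_zero j fun i => ?_).symm
    have hi := i.isLt
    obtain ⟨h0, h1, h2, h3⟩ := hx j
    simp only [upperTriangle, Set.mem_ofPred_eq] at hj
    rw [Matrix.of_apply]
    by_cases hd : (x j).1 = (x j).2
    · exact reflectedCount_diag hd (by omega)
    · rw [reflectedCount, ibinom_of_neg (by omega), ibinom_of_neg (by omega), sub_zero]
  push Not at hZ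
  by_cases hinj : ∃ i j, i ≠ j ∧ x i = x j
  · obtain ⟨i, j, hij, h⟩ := hinj
    rw [inipCount_eq_zero_of_eq hij h, Nat.cast_zero]
    refine (Matrix.det_zero_of_column_eq hij fun k => ?_).symm
    simp only [Matrix.of_apply, h]
  push Not at hinj
  by_cases hbase : ∀ i, (x i).1 + (x i).2 = 2 * ((s : ℤ) + 1)
  · have hlow : ∀ d : ℕ, ∀ h : d < s, (d : ℤ) + 1 ≤ (x ⟨d, h⟩).1 := by
      intro d
      induction d with
      | zero =>
        intro h
        simpa using (hZ ⟨0, h⟩).1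
      | succ d ihd =>
        intro h
        have h1 := ihd (by omega)
        have h2 := hmono ⟨d, by omega⟩ ⟨d + 1, h⟩ (by simp)
        have h3 := hinj ⟨d, by omega⟩ ⟨d + 1, h⟩ (by simp)
        have h4 := hbase ⟨d, by omega⟩
        have h5 := hbase ⟨d + 1, h⟩
        rw [Ne, Prod.ext_iff] at h3
        push_cast
        omega
    have hupp : ∀ e d : ℕ, ∀ h : d < s, d + e + 1 = s → (x ⟨d, h⟩).1 ≤ (d : ℤ) + 1 := by
      intro e
      induction e with
      | zero =>
        intro d h hd
        have h1 := (hZ ⟨d, h⟩).2.1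
        have h2 := hbase ⟨d, h⟩
        omega
      | succ e ihe =>
        intro d h hd
        have h1 := ihe (d + 1) (by omega) (by omega)
        have h2 := hmono ⟨d, h⟩ ⟨d + 1, by omega⟩ (by simp)
        have h3 := hinj ⟨d, h⟩ ⟨d + 1, by omega⟩ (by simp)
        have h4 := hbase ⟨d, h⟩
        have h5 := hbase ⟨d + 1, by omega⟩
        rw [Ne, Prod.ext_iff] at h3
        push_cast at h1
        omega
    have hxe : x = fun i : Fin s => (((i : ℕ) : ℤ) + 1, 2 * (s : ℤ) + 1 - (i : ℕ)) := by
      funext i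
      have h1 := hlow i i.isLt
      have h2 := hupp (s - 1 - i) i i.isLt (by omega)
      have h3 := hbase i
      simp only [Fin.eta] at h1 h2
      ext
      · simp only
        omega
      · simp only
        omega
    rw [Matrix.det_of_isUpperTriangular, Finset.prod_eq_one]
    · rw [← hxe, inipCount_self (fun i j h => by_contra fun hij => hinj i j hij h) hZ, Nat.cast_one]
    · intro i _
      have hi := i.isLt
      rw [Matrix.of_apply, hxe, reflectedCount]
      simp only
      rw [ibinom_of_neg (x := _ - _ - 1) (by omega), sub_self, ibinom_zero (by omega), sub_zero]
    · intro i j hij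
      have hi := i.isLt
      have hij' : (j : ℕ) < i := hij
      rw [Matrix.of_apply, hxe, reflectedCount]
      simp only
      rw [ibinom_of_neg (by omega), ibinom_of_neg (by omega), sub_zero]
  push Not at hbase
  obtain ⟨j₀, hj₀⟩ := hbase
  have : Nonempty (Fin s) := ⟨j₀⟩
  obtain ⟨j, hj⟩ := Finite.exists_max fun i => (x i).1 + (x i).2
  have hjlev : 2 * ((s : ℤ) + 1) < (x j).1 + (x j).2 := by
    have h1 := hj j₀
    have h2 := (hx j₀).2.2.2
    omega
  have hjZ := hZ j
  simp only [upperTriangle, Set.mem_ofPred_eq] at hjZ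
  have hleft : ∀ i, i < j → (x i).1 < (x j).1 := by
    intro i hij
    have h1 := hmono i j hij.le
    have h2 := hanti i j hij.le
    have h3 := hinj i j hij.ne
    have h4 := hj i
    rw [Ne, Prod.ext_iff] at h3
    omega
  have hright : ∀ i, j < i → (x i).2 < (x j).2 := by
    intro i hij
    have h1 := hmono j i hij.le
    have h2 := hanti j i hij.le
    have h3 := hinj j i hij.ne
    have h4 := hj i
    rw [Ne, Prod.ext_iff] at h3
    omega
  have step : ∀ y : ℤ × ℤ, (y = ((x j).1 - 1, (x j).2) ∨ y = ((x j).1, (x j).2 - 1)) →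
      (inipCount (upperTriangle n)
        (fun i : Fin s => (((i : ℕ) : ℤ) + 1, 2 * (s : ℤ) + 1 - (i : ℕ)))
        (Function.update x j y) : ℤ) =
      Matrix.det ((Matrix.of fun i j : Fin s =>
        reflectedCount ((s : ℤ) + 1) (((i : ℕ) : ℤ) + 1) (x j)).updateCol j
          fun i => reflectedCount ((s : ℤ) + 1) (((i : ℕ) : ℤ) + 1) y) := by
    intro y hy
    have hy1 : (x j).1 - 1 ≤ y.1 ∧ y.1 ≤ (x j).1 ∧ (x j).2 - 1 ≤ y.2 ∧ y.2 ≤ (x j).2 ∧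
        y.1 + y.2 = (x j).1 + (x j).2 - 1 := by
      rcases hy with rfl | rfl <;> simp only <;> omega
    have hmat : ((Matrix.of fun i j : Fin s =>
        reflectedCount ((s : ℤ) + 1) (((i : ℕ) : ℤ) + 1) (x j)).updateCol j
          fun i => reflectedCount ((s : ℤ) + 1) (((i : ℕ) : ℤ) + 1) y) =
        Matrix.of fun i k : Fin s =>
          reflectedCount ((s : ℤ) + 1) (((i : ℕ) : ℤ) + 1) (Function.update x j y k) := by
      ext i k
      rcases eq_or_ne k j with rfl | hkj
      · simp
      · simp [hkj]
    rw [hmat]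
    refine ih _ ?_ _ ?_ ?_ ?_ rfl
    · have hsum : (∑ i, ((Function.update x j y i).1 + (Function.update x j y i).2
          - 2 * ((s : ℤ) + 1))) = (∑ i, ((x i).1 + (x i).2 - 2 * ((s : ℤ) + 1))) - 1 := by
        rw [← Finset.add_sum_erase _ _ (Finset.mem_univ j),
          ← Finset.add_sum_erase (a := j) _ (fun i => (x i).1 + (x i).2 - 2 * ((s : ℤ) + 1))
            (Finset.mem_univ j), Function.update_self,
          Finset.sum_congr rfl fun i hi => by
            rw [Function.update_of_ne (Finset.ne_of_mem_erase hi)]]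
        linarith [hy1.2.2.2.2]
      have hpos : 0 < ∑ i, ((x i).1 + (x i).2 - 2 * ((s : ℤ) + 1)) :=
        Finset.sum_pos' (fun i _ => by have := (hx i).2.2.2; omega)
          ⟨j, Finset.mem_univ j, by omega⟩
      rw [hsum]
      omega
    · intro i
      rcases eq_or_ne i j with rfl | hij
      · rw [Function.update_self]
        omega
      · rw [Function.update_of_ne hij]
        exact hx i
    · intro i k hik
      rcases eq_or_ne i j with rfl | hij
      · rcases eq_or_ne k i with rfl | hki
        · rfl
        · rw [Function.update_self, Function.update_of_ne hki]
          have := hmono i k hik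
          omega
      · rw [Function.update_of_ne hij]
        rcases eq_or_ne k j with rfl | hkj
        · rw [Function.update_self]
          have := hleft i (lt_of_le_of_ne hik hij)
          omega
        · rw [Function.update_of_ne hkj]
          exact hmono i k hik
    · intro i k hik
      rcases eq_or_ne i j with rfl | hij
      · rcases eq_or_ne k i with rfl | hki
        · rfl
        · rw [Function.update_self, Function.update_of_ne hki]
          have := hright k (lt_of_le_of_ne hik hki.symm)
          omega
      · rw [Function.update_of_ne hij]
        rcases eq_or_ne k j with rfl | hkj
        · rw [Function.update_self]
          have := hanti i k hik
          omega
        · rw [Function.update_of_ne hkj]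
          exact hanti i k hik
  rw [inipCount_eq_add (hZ j), Nat.cast_add, step _ (Or.inl rfl), step _ (Or.inr rfl),
    ← Matrix.det_updateCol_add]
  · congr 1
    ext i k
    have hi := i.isLt
    rcases eq_or_ne k j with rfl | hkj
    · rw [Matrix.updateCol_self, Matrix.of_apply, Pi.add_apply,
        reflectedCount_eq_add (x := x k) (by omega)]
    · rw [Matrix.updateCol_ne hkj]
  · intro h
    rw [← h] at hjlev
    simp only at hjlev
    omega
  · intro i hij hle
    obtain ⟨h1, h2⟩ := Prod.le_def.1 hle
    have h3 := hinj i j hij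
    have h4 := hj i
    rw [Ne, Prod.ext_iff] at h3
    omega

theorem antiReflect_mem_upperTriangle {n : ℤ} :
    ∀ p ∈ upperTriangle n, antiReflect n p ∈ upperTriangle n := by
  intro p hp
  simp only [upperTriangle, antiReflect, Set.mem_ofPred_eq] at hp ⊢
  omega

theorem inipCount_upperTriangle {s : ℕ} {n : ℤ} (hn : 2 * s + 2 ≤ n) :
    (inipCount (upperTriangle n) (fun i : Fin s => (((i : ℕ) : ℤ) + 1, ((i : ℕ) : ℤ) + 2))
        (fun i : Fin s => (n - (((i : ℕ) : ℤ) + 1), n - (((i : ℕ) : ℤ) + 1) + 1)) : ℤ) =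
      Matrix.det (Matrix.of fun i j : Fin s =>
        reflectedCount ((s : ℤ) + 1) (((i : ℕ) : ℤ) + 1)
          (n - s - 1, n - (((j : ℕ) : ℤ) + 1) + 1)) := by
  rw [inipCount_truncate (c := fun i => n - 2 * s + i),
    ← inipCount_antiReflect antiReflect_mem_upperTriangle]
  · have hstart : (fun i : Fin s => antiReflect n
        (n - 2 * s + ((i : ℕ) : ℤ), n - (((i : ℕ) : ℤ) + 1) + 1)) =
        fun i : Fin s => (((i : ℕ) : ℤ) + 1, 2 * (s : ℤ) + 1 - (i : ℕ)) := by
      funext i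
      simp only [antiReflect, Prod.mk.injEq]
      omega
    have hend : (fun i : Fin s => antiReflect n (((i : ℕ) : ℤ) + 1, ((i : ℕ) : ℤ) + 2)) =
        fun i : Fin s => (n - (((i : ℕ) : ℤ) + 1), n - (((i : ℕ) : ℤ) + 1) + 1) := by
      funext i
      simp only [antiReflect, Prod.mk.injEq]
      omega
    rw [hstart, hend, inipCount_truncate (c := fun _ => n - s - 1),
      inipCount_eq_det_reflectedCount]
    · intro i
      have := i.isLt
      simp only
      omega
    · exact fun _ _ _ => le_rfl
    · intro i j hij
      have : (i : ℕ) ≤ j := hij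
      simp only
      omega
    · intro i
      omega
    · intro i
      omega
    · exact monotone_const
    · intro i _
      exact le_rfl
    · intro i hi
      omega
    · intro i
      have := i.isLt
      simp only
      omega
  · intro i
    omega
  · intro i
    push_cast
    omega
  · intro i j hij
    simp only
    omega
  · intro i hi
    omega
  · intro i hi
    omega
  · intro i
    simp only
    omega

theorem stmt17 (r n : ℕ) (hr : 1 ≤ r) (hrn : 2 * r ≤ n)
    (Z : Set (ℤ × ℤ))
    (hZ : Z = {p : ℤ × ℤ | 1 ≤ p.1 ∧ p.1 < p.2 ∧ p.2 ≤ (n : ℤ)}) :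
    (inipCount Z (fun i : Fin (r - 1) => (((i : ℕ) : ℤ) + 1, ((i : ℕ) : ℤ) + 2))
        (fun i : Fin (r - 1) => ((n : ℤ) - (((i : ℕ) : ℤ) + 1),
          (n : ℤ) - (((i : ℕ) : ℤ) + 1) + 1)) : ℤ) =
      Matrix.det (Matrix.of fun i j : Fin (r - 1) =>
        ibinom (2 * (n : ℤ) - 2 * r - (((i : ℕ) : ℤ) + 1) - (((j : ℕ) : ℤ) + 1))
            ((n : ℤ) - r - (((i : ℕ) : ℤ) + 1)) -
          ibinom (2 * (n : ℤ) - 2 * r - (((i : ℕ) : ℤ) + 1) - (((j : ℕ) : ℤ) + 1))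
            ((n : ℤ) - 2 * r - 1)) := by
  obtain ⟨s, rfl⟩ : ∃ s, r = s + 1 := ⟨r - 1, by omega⟩
  subst hZ
  refine (inipCount_upperTriangle (s := s) (n := n) (by omega)).trans ?_
  congr 1
  ext i j
  simp only [Matrix.of_apply, reflectedCount]
  congr 2 <;> push_cast <;> ring
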